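/- The following identity between composed relations holds: Δ_{V∖W} R^{-W} ((E^W)*)ᵒ (E^W)* R^W Δ_{V∖W} = Δ_{V∖W} A^W Δ_{V∖W}, where R^W = Δ ∪ C^W (B^{-W} ∪ K^W) and R^{-W} = (R^W)ᵒ = Δ ∪ (B^W ∪ K^W) C^W. -/

import Mathlib

/-- The subdiagonal relation `Δ_S`. -/
def diag {V : Type*} (S : Set V) : V → V → Prop := fun a b => a = b ∧ a ∈ S

/-- Foreset `R B = {a : ∃ b ∈ B, a R b}`. -/
def foreset {V : Type*} (R : V → V → Prop) (B : Set V) : Set V := {a | ∃ b ∈ B, R a b}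

/-- Conditional parental relation `E^W = Δ_{V∖W} E`. -/
def condParent {V : Type*} (E : V → V → Prop) (W : Set V) : V → V → Prop :=
  Relation.Comp (diag Wᶜ) E

/-- Conditional ascendent relation `B^W = E (E^W)*`. -/
def condAsc {V : Type*} (E : V → V → Prop) (W : Set V) : V → V → Prop :=
  Relation.Comp E (Relation.ReflTransGen (condParent E W))

/-- `B^{-W} = (B^W)ᵒ`. -/
def condAscConv {V : Type*} (E : V → V → Prop) (W : Set V) : V → V → Prop :=
  flip (condAsc E W)

/-- Conditional common cause relation `K^W = ((E^W)⁺)ᵒ (E^W)⁺`. -/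
def condK {V : Type*} (E : V → V → Prop) (W : Set V) : V → V → Prop :=
  Relation.Comp (flip (Relation.TransGen (condParent E W))) (Relation.TransGen (condParent E W))

/-- Conditional cousinhood relation `C^W = (Δ_W K^W Δ_W)⁺ ∪ Δ_W`. -/
def condC {V : Type*} (E : V → V → Prop) (W : Set V) : V → V → Prop := fun a b =>
  Relation.TransGen (Relation.Comp (Relation.Comp (diag W) (condK E W)) (diag W)) a b ∨
    diag W a b

/-- Conditional active relation
`A^W = Δ ∪ B^W ∪ B^{-W} ∪ K^W ∪ (B^W ∪ K^W) C^W (B^{-W} ∪ K^W)`. -/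
def condA {V : Type*} (E : V → V → Prop) (W : Set V) : V → V → Prop := fun a b =>
  a = b ∨ condAsc E W a b ∨ condAscConv E W a b ∨ condK E W a b ∨
    Relation.Comp
      (Relation.Comp (fun x y => condAsc E W x y ∨ condK E W x y) (condC E W))
      (fun x y => condAscConv E W x y ∨ condK E W x y) a b

/-- The relation `R^W = Δ ∪ C^W (B^{-W} ∪ K^W)`. -/
def condR {V : Type*} (E : V → V → Prop) (W : Set V) : V → V → Prop := fun a b =>
  a = b ∨
    Relation.Comp (condC E W) (fun x y => condAscConv E W x y ∨ condK E W x y) a b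

/-- Conditional topological closure `cl_W(B) = (E^W)* B`. -/
def clW {V : Type*} (E : V → V → Prop) (W : Set V) (B : Set V) : Set V :=
  foreset (Relation.ReflTransGen (condParent E W)) B

local infixr:80 " ⬝ " => Relation.Comp

theorem condK_symm' {V : Type*} {E : V → V → Prop} {W : Set V} {a b : V}
    (h : condK E W a b) : condK E W b a := by
  obtain ⟨z, h1, h2⟩ := h
  exact ⟨z, h2, h1⟩

theorem condC_symm' {V : Type*} {E : V → V → Prop} {W : Set V} {a b : V}
    (h : condC E W a b) : condC E W b a := by
  rcases h with h | ⟨rfl, h⟩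
  · left
    induction h with
    | single h =>
      obtain ⟨_, ⟨_, ⟨rfl, h1⟩, h2⟩, ⟨rfl, h3⟩⟩ := h
      exact .single ⟨_, ⟨_, ⟨rfl, h3⟩, condK_symm' h2⟩, ⟨rfl, h1⟩⟩
    | tail _ h ih =>
      obtain ⟨_, ⟨_, ⟨rfl, h1⟩, h2⟩, ⟨rfl, h3⟩⟩ := h
      exact .head ⟨_, ⟨_, ⟨rfl, h3⟩, condK_symm' h2⟩, ⟨rfl, h1⟩⟩ ih
  · exact Or.inr ⟨rfl, h⟩

theorem condC_trans' {V : Type*} {E : V → V → Prop} {W : Set V} {a b c : V}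
    (h : condC E W a b) (h' : condC E W b c) : condC E W a c := by
  rcases h with h | ⟨rfl, h⟩
  · rcases h' with h' | ⟨rfl, h'⟩
    · exact Or.inl (h.trans h')
    · exact Or.inl h
  · exact h'

theorem condC_mem' {V : Type*} {E : V → V → Prop} {W : Set V} {a b : V}
    (h : condC E W a b) : a ∈ W := by
  rcases h with h | ⟨rfl, h⟩
  · induction h with
    | single h =>
      obtain ⟨_, ⟨_, ⟨rfl, h1⟩, h2⟩, ⟨rfl, h3⟩⟩ := h
      exact h1
    | tail _ h ih => exact ih
  · exact h

theorem plus_iff' {V : Type*} {E : V → V → Prop} {W : Set V} {a b : V} :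
    Relation.TransGen (condParent E W) a b ↔ a ∉ W ∧ condAsc E W a b := by
  rw [Relation.TransGen.head'_iff]
  constructor
  · rintro ⟨c, ⟨_, ⟨rfl, h1⟩, h2⟩, h3⟩
    exact ⟨h1, c, h2, h3⟩
  · rintro ⟨h1, c, h2, h3⟩
    exact ⟨c, ⟨_, ⟨rfl, h1⟩, h2⟩, h3⟩

theorem middle' {V : Type*} {E : V → V → Prop} {W : Set V} {x y z : V}
    (h1 : Relation.ReflTransGen (condParent E W) z x)
    (h2 : Relation.ReflTransGen (condParent E W) z y) :
    x = y ∨ (x ∉ W ∧ condAsc E W x y) ∨ (y ∉ W ∧ condAsc E W y x) ∨ condK E W x y := by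
  rw [Relation.reflTransGen_iff_eq_or_transGen] at h1 h2
  rcases h1 with rfl | h1 <;> rcases h2 with rfl | h2
  · exact Or.inl rfl
  · exact Or.inr (Or.inl (plus_iff'.1 h2))
  · exact Or.inr (Or.inr (Or.inl (plus_iff'.1 h1)))
  · exact Or.inr (Or.inr (Or.inr ⟨z, h1, h2⟩))

theorem bk_symm' {V : Type*} {E : V → V → Prop} {W : Set V} {u a : V} :
    (condAscConv E W u a ∨ condK E W u a) ↔ (condAsc E W a u ∨ condK E W a u) :=
  or_congr Iff.rfl ⟨condK_symm', condK_symm'⟩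

/-- `Δ_{V∖W} R^{-W} ((E^W)*)ᵒ (E^W)* R^W Δ_{V∖W} = Δ_{V∖W} A^W Δ_{V∖W}`,
where `R^W = Δ ∪ C^W (B^{-W} ∪ K^W)` and `R^{-W} = (R^W)ᵒ`. -/
theorem relation_identity_18 (V : Type*) [Nonempty V] (E : V → V → Prop) (W : Set V) :
    (diag Wᶜ ⬝
      flip (condR E W) ⬝
      flip (Relation.ReflTransGen (condParent E W)) ⬝
      Relation.ReflTransGen (condParent E W) ⬝
      condR E W ⬝
      diag Wᶜ)
    = (diag Wᶜ ⬝ condA E W ⬝ diag Wᶜ) := by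
  funext a b
  apply propext
  constructor
  · rintro ⟨_, ⟨rfl, ha⟩, x, hx, z, hzx, y, hzy, b', hy, ⟨rfl, hb⟩⟩
    refine ⟨a, ⟨rfl, ha⟩, b', ?_, ⟨rfl, hb⟩⟩
    have hm := middle' hzx hzy
    rcases hx with rfl | ⟨u, hxu, hua⟩ <;> rcases hy with rfl | ⟨v, hyv, hvb⟩
    · rcases hm with h | h | h | h
      · exact Or.inl h
      · exact Or.inr (Or.inl h.2)
      · exact Or.inr (Or.inr (Or.inl h.2))
      · exact Or.inr (Or.inr (Or.inr (Or.inl h)))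
    · have hyW := condC_mem' hyv
      refine Or.inr (Or.inr (Or.inr (Or.inr ⟨v, ⟨y, ?_, hyv⟩, hvb⟩)))
      rcases hm with h | h | h | h
      · exact absurd (h ▸ hyW) ha
      · exact Or.inl h.2
      · exact absurd hyW h.1
      · exact Or.inr h
    · have hxW := condC_mem' hxu
      refine Or.inr (Or.inr (Or.inr (Or.inr
        ⟨x, ⟨u, bk_symm'.1 hua, condC_symm' hxu⟩, ?_⟩)))
      rcases hm with h | h | h | h
      · exact absurd (h ▸ hxW) hb
      · exact absurd hxW h.1
      · exact Or.inl h.2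
      · exact Or.inr h
    · have hxW := condC_mem' hxu
      have hyW := condC_mem' hyv
      have hxy : condC E W x y := by
        rcases hm with h | h | h | h
        · exact Or.inr ⟨h, hxW⟩
        · exact absurd hxW h.1
        · exact absurd hyW h.1
        · exact Or.inl (.single ⟨_, ⟨_, ⟨rfl, hxW⟩, h⟩, ⟨rfl, hyW⟩⟩)
      exact Or.inr (Or.inr (Or.inr (Or.inr ⟨v, ⟨u, bk_symm'.1 hua,
        condC_trans' (condC_symm' hxu) (condC_trans' hxy hyv)⟩, hvb⟩)))
  · rintro ⟨_, ⟨rfl, ha⟩, b', h, ⟨rfl, hb⟩⟩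
    refine ⟨a, ⟨rfl, ha⟩, ?_⟩
    rcases h with rfl | h | h | ⟨z, h1, h2⟩ | ⟨v, ⟨u, hau, huv⟩, hvb⟩
    · exact ⟨a, Or.inl rfl, a, .refl, a, .refl, a, Or.inl rfl, rfl, hb⟩
    · exact ⟨a, Or.inl rfl, a, .refl, b', (plus_iff'.2 ⟨ha, h⟩).to_reflTransGen, b',
        Or.inl rfl, rfl, hb⟩
    · exact ⟨a, Or.inl rfl, b', (plus_iff'.2 ⟨hb, h⟩).to_reflTransGen, b', .refl, b',
        Or.inl rfl, rfl, hb⟩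
    · exact ⟨a, Or.inl rfl, z, h1.to_reflTransGen, b', h2.to_reflTransGen, b',
        Or.inl rfl, rfl, hb⟩
    · exact ⟨u, Or.inr ⟨u, Or.inr ⟨rfl, condC_mem' huv⟩, bk_symm'.2 hau⟩, u, .refl, u, .refl,
        b', Or.inr ⟨v, huv, hvb⟩, rfl, hb⟩
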